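/- NoColor soundness of spec: if σ = ⟨b, RetrieveRequest(c)⟩ is a valid state with c ∈ {red, white, blue} and the evaluation of spec from σ executes the external command DoesNotHaveColor, then no bay of b holds color c (equivalently, find_color c 1 b = None); dually, if the evaluation executes HasColor, then some bay of b holds c. -/

import Mathlib

/-- Colors of items (and `empty` for an empty bay). -/
inductive Color
  | empty | red | white | blue
deriving DecidableEq, Repr

/-- The high-bay warehouse: a record of nine bays, each holding a color. -/
structure Bays where
  bay1 : Color
  bay2 : Color
  bay3 : Color
  bay4 : Color
  bay5 : Color
  bay6 : Color
  bay7 : Color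
  bay8 : Color
  bay9 : Color
deriving DecidableEq, Repr

/-- `bf b n` returns the color of bay `n` (for `1 ≤ n ≤ 9`). -/
def bf (b : Bays) : ℕ → Color
  | 1 => b.bay1
  | 2 => b.bay2
  | 3 => b.bay3
  | 4 => b.bay4
  | 5 => b.bay5
  | 6 => b.bay6
  | 7 => b.bay7
  | 8 => b.bay8
  | 9 => b.bay9
  | _ => Color.empty

/-- Update bay `n` to hold color `c`. -/
def setBay (b : Bays) (n : ℕ) (c : Color) : Bays :=
  match n with
  | 1 => { b with bay1 := c }
  | 2 => { b with bay2 := c }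
  | 3 => { b with bay3 := c }
  | 4 => { b with bay4 := c }
  | 5 => { b with bay5 := c }
  | 6 => { b with bay6 := c }
  | 7 => { b with bay7 := c }
  | 8 => { b with bay8 := c }
  | 9 => { b with bay9 := c }
  | _ => b

/-- `findColor c n b` returns the least index `m` with `n ≤ m ≤ 9` and `bf b m = c`,
or `none` if no such index exists. -/
def findColor (c : Color) (n : ℕ) (b : Bays) : Option ℕ :=
  if _h : n ≤ 9 then
    if bf b n = c then some n else findColor c (n + 1) b
  else none
termination_by 10 - n
decreasing_by omega

/-- User inputs: a request to retrieve or store an item of a given color. -/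
inductive Input
  | RetrieveRequest (c : Color)
  | StoreRequest (c : Color)
deriving DecidableEq, Repr

/-- The color requested by an input. -/
def requestedColor : Input → Color
  | .RetrieveRequest c => c
  | .StoreRequest c => c

/-- A state is either a valid state `⟨bays, input⟩` or the error state `Wrong`. -/
inductive State
  | Sigma (b : Bays) (i : Input)
  | Wrong
deriving DecidableEq, Repr

/-- External commands (RPCs). -/
inductive ExtCom
  | IsFull | NotFull | HasColor | DoesNotHaveColor
  | Store (c : Color)
  | Retrieve (c : Color)
deriving DecidableEq, Repr

/-- Atomic propositions. -/
inductive AP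
  | APHasStoreRequest | APHasRetrieveRequest | APBaysFull
  | APRequestRed | APRequestWhite | APRequestBlue
  | APContainsRed | APContainsWhite | APContainsBlue
deriving DecidableEq, Repr

/-- Internal commands of the DSL. -/
inductive IntCom
  | Skip
  | Seq (t1 t2 : IntCom)
  | If (p : AP) (t1 t2 : IntCom)
  | Ext (e : ExtCom)
deriving DecidableEq, Repr

/-- All nine bays are nonempty. -/
def baysFullB (b : Bays) : Bool :=
  (List.range' 1 9).all fun n => !(bf b n == Color.empty)

/-- Some bay holds color `c`. -/
def containsC (b : Bays) (c : Color) : Bool :=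
  (List.range' 1 9).any fun n => bf b n == c

/-- Evaluation of an atomic proposition in a valid state `⟨b, i⟩`. -/
def evalAP (p : AP) (b : Bays) (i : Input) : Bool :=
  match p with
  | .APHasStoreRequest => (match i with | .StoreRequest _ => true | _ => false)
  | .APHasRetrieveRequest => (match i with | .RetrieveRequest _ => true | _ => false)
  | .APBaysFull => baysFullB b
  | .APRequestRed => requestedColor i = Color.red
  | .APRequestWhite => requestedColor i = Color.white
  | .APRequestBlue => requestedColor i = Color.blue
  | .APContainsRed => containsC b Color.red
  | .APContainsWhite => containsC b Color.white
  | .APContainsBlue => containsC b Color.blue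

/-- Evaluation of an atomic proposition in a state (no proposition holds at `Wrong`). -/
def evalAtomicProp (p : AP) : State → Bool
  | .Sigma b i => evalAP p b i
  | .Wrong => false

/-- The labeling function `L : State → 2^AP`. -/
def labelFn (st : State) : Set AP := {p | evalAtomicProp p st = true}

/-- The atomic proposition `APContains⟨c⟩` for `c ∈ {red, white, blue}`. -/
def containsAP : Color → AP
  | .red => AP.APContainsRed
  | .white => AP.APContainsWhite
  | .blue => AP.APContainsBlue
  | .empty => AP.APContainsRed  -- irrelevant: only used for c ∈ {red, white, blue}

/-- The small-step semantics `→_EC` of external commands, as a function. -/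
def stepEC (e : ExtCom) (st : State) : State :=
  match st with
  | .Wrong => .Wrong
  | .Sigma b i =>
    match e with
    | .IsFull => if baysFullB b then st else .Wrong
    | .NotFull => if baysFullB b then .Wrong else st
    | .HasColor => if containsC b (requestedColor i) then st else .Wrong
    | .DoesNotHaveColor => if containsC b (requestedColor i) then .Wrong else st
    | .Store c =>
      match findColor Color.empty 1 b with
      | some n => .Sigma (setBay b n c) i
      | none => .Wrong
    | .Retrieve c =>
      match findColor c 1 b with
      | some n => .Sigma (setBay b n Color.empty) i
      | none => .Wrong

/-- The labeled small-step semantics of internal commands: a step carries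
`some e` when it executes the external command `e`, and `none` otherwise. -/
inductive StepL : IntCom × State → Option ExtCom → IntCom × State → Prop
  | ext (e : ExtCom) (st : State) :
      StepL (.Ext e, st) (some e) (.Skip, stepEC e st)
  | seq_skip (t : IntCom) (st : State) :
      StepL (.Seq .Skip t, st) none (t, st)
  | seq_step {t1 t1' t2 : IntCom} {st st' : State} {l : Option ExtCom} :
      StepL (t1, st) l (t1', st') →
      StepL (.Seq t1 t2, st) l (.Seq t1' t2, st')
  | if_true {p : AP} {t1 t2 : IntCom} {st : State} :
      evalAtomicProp p st = true → StepL (.If p t1 t2, st) none (t1, st)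
  | if_false {p : AP} {t1 t2 : IntCom} {st : State} :
      evalAtomicProp p st = false → StepL (.If p t1 t2, st) none (t2, st)

/-- The small-step semantics `→_IC` of internal commands. -/
def StepIC (c c' : IntCom × State) : Prop := ∃ l, StepL c l c'

/-- `⟨t, σ⟩ ↝ ψ`: evaluation of `t` from `σ` reaches `⟨Skip, ψ⟩`. -/
def Evaluates (t : IntCom) (σ ψ : State) : Prop :=
  Relation.ReflTransGen StepIC (t, σ) (IntCom.Skip, ψ)

/-- `EmitsTo c tr c'`: configuration `c` multi-steps to `c'` executing exactly the
external commands of `tr`, in order. -/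
inductive EmitsTo : IntCom × State → List ExtCom → IntCom × State → Prop
  | refl (c : IntCom × State) : EmitsTo c [] c
  | step {c c' c'' : IntCom × State} {l : Option ExtCom} {tr : List ExtCom} :
      StepL c l c' → EmitsTo c' tr c'' → EmitsTo c (l.toList ++ tr) c''

/-- The protocol term `spec`. -/
def spec : IntCom :=
  .If .APHasStoreRequest
    (.If .APBaysFull (.Ext .IsFull)
      (.Seq (.Ext .NotFull)
        (.If .APRequestRed (.Ext (.Store .red))
          (.If .APRequestWhite (.Ext (.Store .white))
            (.If .APRequestBlue (.Ext (.Store .blue)) .Skip)))))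
    (.If .APHasRetrieveRequest
      (.If .APRequestRed
        (.If .APContainsRed (.Seq (.Ext .HasColor) (.Ext (.Retrieve .red)))
          (.Ext .DoesNotHaveColor))
        (.If .APRequestWhite
          (.If .APContainsWhite (.Seq (.Ext .HasColor) (.Ext (.Retrieve .white)))
            (.Ext .DoesNotHaveColor))
          (.If .APRequestBlue
            (.If .APContainsBlue (.Seq (.Ext .HasColor) (.Ext (.Retrieve .blue)))
              (.Ext .DoesNotHaveColor))
            .Skip)))
      .Skip)

/-- `Generates t σ tr`: the trace `tr` is generated by evaluating `t` from `σ`,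
restarting `spec` in the resulting state whenever evaluation reaches `Skip`
(for as long as commands of `tr` remain). -/
inductive Generates : IntCom → State → List ExtCom → Prop
  | nil (t : IntCom) (σ : State) : Generates t σ []
  | emit {t t' : IntCom} {σ σ' : State} {e : ExtCom} {tr : List ExtCom} :
      EmitsTo (t, σ) [e] (t', σ') → Generates t' σ' tr → Generates t σ (e :: tr)
  | restart {t : IntCom} {σ σ' : State} {tr : List ExtCom} :
      EmitsTo (t, σ) [] (.Skip, σ') → Generates spec σ' tr → Generates t σ tr

/-- Execute a list of external commands from a state. -/
def runTrace (st : State) : List ExtCom → State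
  | [] => st
  | e :: tr => runTrace (stepEC e st) tr

/-- Evaluate an internal command from a state up to (and including) the next
external command, returning that command (or `none` if evaluation reaches `Skip`
without executing one), the remaining internal command (or `none`), and the
resulting state. -/
def evalUntilNextCom (st : State) : IntCom → Option ExtCom × Option IntCom × State
  | .Skip => (none, none, st)
  | .Ext e => (some e, none, stepEC e st)
  | .Seq t1 t2 =>
    match evalUntilNextCom st t1 with
    | (none, _, st') => evalUntilNextCom st' t2
    | (some e, none, st') => (some e, some t2, st')
    | (some e, some t1', st') => (some e, some (.Seq t1' t2), st')
  | .If p t1 t2 => if evalAtomicProp p st then evalUntilNextCom st t1 else evalUntilNextCom st t2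

/-- The trace decider. -/
def isTrace (t : IntCom) (tr : List ExtCom) (st : State) : Bool :=
  match tr with
  | [] => true
  | com :: tr' =>
    match evalUntilNextCom st t with
    | (none, _, _) => false
    | (some com', none, st') => com = com' && isTrace spec tr' st'
    | (some com', some t', st') => com = com' && isTrace t' tr' st'
termination_by tr.length
decreasing_by all_goals simp

/-- The external commands occurring in an internal command. -/
def IntCom.extComs : IntCom → Set ExtCom
  | .Skip => ∅
  | .Seq t1 t2 => t1.extComs ∪ t2.extComs
  | .If _ t1 t2 => t1.extComs ∪ t2.extComs
  | .Ext e => {e}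

/-- Evaluation of the configuration `x` executes the external command `e` at some point. -/
def Executes (x : IntCom × State) (e : ExtCom) : Prop :=
  ∃ y z, Relation.ReflTransGen StepIC x y ∧ StepL y (some e) z

theorem StepL.extComs_subset {x y : IntCom × State} {l : Option ExtCom} (h : StepL x l y) :
    y.1.extComs ⊆ x.1.extComs := by
  induction h with
  | ext e st => exact Set.empty_subset _
  | seq_skip t st => exact Set.subset_union_right
  | seq_step _ ih => exact Set.union_subset_union_left _ ih
  | if_true _ => exact Set.subset_union_left
  | if_false _ => exact Set.subset_union_right

theorem StepL.mem_extComs {x y : IntCom × State} {e : ExtCom} (h : StepL x (some e) y) :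
    e ∈ x.1.extComs := by
  generalize hl : some e = l at h
  induction h with
  | ext e' st => exact Option.some.inj hl
  | seq_step _ ih => exact Or.inl (ih hl)
  | seq_skip | if_true | if_false => cases hl

theorem Executes.mem_extComs {x : IntCom × State} {e : ExtCom} (h : Executes x e) :
    e ∈ x.1.extComs := by
  obtain ⟨y, z, hxy, hyz⟩ := h
  induction hxy using Relation.ReflTransGen.head_induction_on with
  | refl => exact hyz.mem_extComs
  | head hstep _ ih =>
    obtain ⟨l, hl⟩ := hstep
    exact hl.extComs_subset ih

theorem Executes.of_if {p : AP} {t1 t2 : IntCom} {σ : State} {e : ExtCom}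
    (h : Executes (.If p t1 t2, σ) e) :
    Executes (if evalAtomicProp p σ then t1 else t2, σ) e := by
  obtain ⟨y, z, hxy, hyz⟩ := h
  rcases hxy.cases_head with rfl | ⟨w, ⟨l, hl⟩, hwy⟩
  · cases hyz
  · cases hl with
    | if_true hp => exact ⟨y, z, by simpa [hp] using hwy, hyz⟩
    | if_false hp => exact ⟨y, z, by simpa [hp] using hwy, hyz⟩

theorem findColor_eq_none_iff (c : Color) (n : ℕ) (b : Bays) :
    findColor c n b = none ↔ ∀ m, n ≤ m → m ≤ 9 → bf b m ≠ c := by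
  fun_induction findColor c n b with
  | case1 n hn hc => simpa using ⟨n, le_rfl, hn, hc⟩
  | case2 n hn hc ih =>
    rw [ih]
    refine ⟨fun h m hm => ?_, fun h m hm => h m (by omega)⟩
    rcases hm.eq_or_lt with rfl | hlt
    · exact fun _ => hc
    · exact h m hlt
  | case3 n hn => exact ⟨fun _ m _ _ => by omega, fun _ => rfl⟩

theorem findColor_one_eq_none_iff (c : Color) (b : Bays) :
    findColor c 1 b = none ↔ containsC b c = false := by
  rw [findColor_eq_none_iff]
  simp only [containsC, List.any_eq_false, List.mem_range'_1, beq_iff_eq]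
  exact ⟨fun h m hm => h m hm.1 (by omega), fun h m h1 h9 => h m ⟨h1, by omega⟩⟩

/-- On a request to retrieve `c`, evaluation of `spec` commits to one of two branches,
according to whether some bay holds `c`. -/
theorem Executes.of_spec_retrieve {b : Bays} {c : Color} {e : ExtCom}
    (hc : c = Color.red ∨ c = Color.white ∨ c = Color.blue)
    (h : Executes (spec, .Sigma b (.RetrieveRequest c)) e) :
    if containsC b c then e = .HasColor ∨ e = .Retrieve c else e = .DoesNotHaveColor := by
  have h_retrieve := h.of_if.of_if
  have hmem : e ∈ (if containsC b c then .Seq (.Ext .HasColor) (.Ext (.Retrieve c))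
      else .Ext .DoesNotHaveColor : IntCom).extComs := by
    rcases hc with rfl | rfl | rfl
    · exact h_retrieve.of_if.of_if.mem_extComs
    · exact h_retrieve.of_if.of_if.of_if.mem_extComs
    · exact h_retrieve.of_if.of_if.of_if.of_if.mem_extComs
  split_ifs with hb <;> simpa [hb, IntCom.extComs, or_comm] using hmem

/-- NoColor soundness of `spec`: if evaluating `spec` from
`⟨b, RetrieveRequest c⟩` executes `DoesNotHaveColor` then no bay holds `c`;
dually for `HasColor`. -/
theorem noColor_sound (b : Bays) (c : Color)
    (hc : c = Color.red ∨ c = Color.white ∨ c = Color.blue) :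
    ((∃ (t t'' : IntCom) (σ' σ'' : State),
        Relation.ReflTransGen StepIC
          (spec, State.Sigma b (Input.RetrieveRequest c)) (t, σ') ∧
        StepL (t, σ') (some ExtCom.DoesNotHaveColor) (t'', σ'')) →
      findColor c 1 b = none) ∧
    ((∃ (t t'' : IntCom) (σ' σ'' : State),
        Relation.ReflTransGen StepIC
          (spec, State.Sigma b (Input.RetrieveRequest c)) (t, σ') ∧
        StepL (t, σ') (some ExtCom.HasColor) (t'', σ'')) →
      ∃ n, findColor c 1 b = some n) := by
  constructor
  · rintro ⟨t, t'', σ', σ'', hsteps, hstep⟩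
    have h := Executes.of_spec_retrieve hc ⟨_, _, hsteps, hstep⟩
    rw [findColor_one_eq_none_iff]
    by_contra hb
    simp [hb] at h
  · rintro ⟨t, t'', σ', σ'', hsteps, hstep⟩
    have h := Executes.of_spec_retrieve hc ⟨_, _, hsteps, hstep⟩
    rw [← Option.ne_none_iff_exists', Ne, findColor_one_eq_none_iff]
    intro hb
    simp [hb] at h
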